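/- For every integer k ≥ 1 there exists a set of 6^k points in general position in the plane ℝ² whose number of halving edges is at least k·6^k. (Consequently there exist n-point configurations with at least on the order of n·log n halving edges.) -/

import Mathlib

noncomputable section

/-- The plane. -/
abbrev Pt : Type := EuclideanSpace ℝ (Fin 2)

/-- Signed determinant of the triple `(p, q, r)`: positive iff `r` lies on the left of
the directed line from `p` to `q`. -/
def det2 (p q r : Pt) : ℝ :=
  (q 0 - p 0) * (r 1 - p 1) - (q 1 - p 1) * (r 0 - p 0)

/-- A finite set of points in the plane is in general position if no three of its
(distinct) points are collinear. -/
def GenPos (S : Finset Pt) : Prop :=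
  ∀ p ∈ S, ∀ q ∈ S, ∀ r ∈ S, p ≠ q → p ≠ r → q ≠ r →
    ¬ Collinear ℝ ({p, q, r} : Set Pt)

/-- `{p, q}` is a halving edge of `S`: `p, q` are distinct points of `S` and the open
half-planes on the two sides of the line through `p` and `q` each contain exactly
`(|S| - 2)/2` points of `S`. -/
def HalvingEdge (S : Finset Pt) (p q : Pt) : Prop :=
  p ∈ S ∧ q ∈ S ∧ p ≠ q ∧
    {r ∈ (S : Set Pt) | 0 < det2 p q r}.ncard = (S.card - 2) / 2 ∧
    {r ∈ (S : Set Pt) | det2 p q r < 0}.ncard = (S.card - 2) / 2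

/-- The halving edges graph of `S` (as a graph on the whole plane; all vertices
outside `S` are isolated). -/
def halvingGraph (S : Finset Pt) : SimpleGraph Pt :=
  SimpleGraph.fromRel (HalvingEdge S)

/-- The number of halving edges of `S`. -/
def halvingEdgeCount (S : Finset Pt) : ℕ :=
  {e : Sym2 Pt | ∃ p q, e = s(p, q) ∧ HalvingEdge S p q}.ncard

/-- `H`, together with the cluster map `cl`, is a `k`-fission of `S` within `ε`:
`H` is a set of `k * |S|` points in general position partitioned into clusters
`cl v` of `k` points, one for each `v ∈ S`, with each point of the `v`-cluster
within distance `ε` of `v`. -/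
structure IsFission (S : Finset Pt) (k : ℕ) (ε : ℝ) (H : Finset Pt)
    (cl : Pt → Finset Pt) : Prop where
  genPos : GenPos H
  cluster_card : ∀ v ∈ S, (cl v).card = k
  disj : ∀ v ∈ S, ∀ w ∈ S, v ≠ w → Disjoint (cl v) (cl w)
  union_eq : (H : Set Pt) = ⋃ v ∈ S, (cl v : Set Pt)
  close : ∀ v ∈ S, ∀ x ∈ cl v, dist x v ≤ ε

/-- A fission is plain if no halving edge of `H` has both endpoints in the same cluster. -/
def IsPlain (S : Finset Pt) (H : Finset Pt) (cl : Pt → Finset Pt) : Prop :=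
  ∀ v ∈ S, ∀ p ∈ cl v, ∀ q ∈ cl v, ¬ HalvingEdge H p q


local instance : DecidableEq Pt := Classical.decEq _

open Filter Topology Function

/-- The sign of a real number, as an integer. -/
def isgn (r : ℝ) : ℤ := (SignType.sign r : ℤ)

lemma isgn_zero : isgn 0 = 0 := by simp [isgn]

lemma isgn_pos {r : ℝ} (h : 0 < r) : isgn r = 1 := by simp [isgn, sign_pos h]

lemma isgn_of_neg {r : ℝ} (h : r < 0) : isgn r = -1 := by simp [isgn, sign_neg h]

lemma isgn_mul (r s : ℝ) : isgn (r * s) = isgn r * isgn s := by simp [isgn, sign_mul]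

lemma isgn_neg (r : ℝ) : isgn (-r) = -isgn r := by simp [isgn, Left.sign_neg]

lemma isgn_sub_comm (r s : ℝ) : isgn (r - s) = -isgn (s - r) := by
  rw [← isgn_neg, neg_sub]

lemma isgn_eq_zero {r : ℝ} : isgn r = 0 ↔ r = 0 := by
  rcases lt_trichotomy r 0 with h | h | h
  · simp [isgn_of_neg h, h.ne]
  · simp [h, isgn_zero]
  · simp [isgn_pos h, h.ne']

lemma isgn_intCast (n : ℤ) : isgn n = n.sign := by
  rcases lt_trichotomy n 0 with h | h | h
  · rw [isgn_of_neg (by exact_mod_cast h), Int.sign_eq_neg_one_of_neg h]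
  · simp [h, isgn_zero]
  · rw [isgn_pos (by exact_mod_cast h), Int.sign_eq_one_of_pos h]

/-- A function of the form `ε ^ m * h ε` has, for small positive `ε`, the sign of `h 0`. -/
lemma eventually_isgn_eq {g h : ℝ → ℝ} (m : ℕ) (hg : ∀ ε, g ε = ε ^ m * h ε)
    (hh : Continuous h) (h0 : h 0 ≠ 0) : ∀ᶠ ε in 𝓝[>] (0 : ℝ), isgn (g ε) = isgn (h 0) := by
  have hpos : ∀ᶠ ε in 𝓝[>] (0 : ℝ), 0 < ε := eventually_mem_nhdsWithin
  have ht : Tendsto h (𝓝[>] 0) (𝓝 (h 0)) := hh.continuousAt.mono_left nhdsWithin_le_nhds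
  rcases lt_or_gt_of_ne h0 with hn | hp
  · filter_upwards [hpos, ht.eventually_lt_const hn] with ε he hlt
    rw [hg, isgn_mul, isgn_pos (pow_pos he m), one_mul, isgn_of_neg hlt, isgn_of_neg hn]
  · filter_upwards [hpos, ht.eventually_const_lt hp] with ε he hlt
    rw [hg, isgn_mul, isgn_pos (pow_pos he m), one_mul, isgn_pos hlt, isgn_pos hp]

/-- The signed determinant of the `i`-th, `j`-th and `l`-th points of the family with
coordinates `x` and `y`. -/
def orient {ι : Type*} (x y : ι → ℝ) (i j l : ι) : ℝ :=
  (x j - x i) * (y l - y i) - (y j - y i) * (x l - x i)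

section orient

variable {ι : Type*} (x y : ι → ℝ) (i j l : ι)

lemma orient_rotate : orient x y i j l = orient x y j l i := by
  unfold orient; ring

lemma orient_self_left : orient x y i i l = 0 := by
  unfold orient; ring

lemma orient_self_right : orient x y i j j = 0 := by
  unfold orient; ring

lemma orient_self_outer : orient x y i j i = 0 := by
  unfold orient; ring

end orient

/-- A planar family in general position with distinct first coordinates, together with a set `E`
of pairs spanning halving lines, each line being listed in one direction only. -/
structure IsHalvingSystem {ι : Type*} [Fintype ι] (x y : ι → ℝ) (E : Finset (ι × ι)) : Prop where
  inj : Injective x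
  genPos : ∀ i j l, i ≠ j → i ≠ l → j ≠ l → orient x y i j l ≠ 0
  halving : ∀ p ∈ E, ∑ l, isgn (orient x y p.1 p.2 l) = 0
  asymm : ∀ p ∈ E, p.swap ∉ E

section reindex

variable {ι κ : Type*} [Fintype ι] [Fintype κ] {x y : ι → ℝ} {E : Finset (ι × ι)}

lemma IsHalvingSystem.ne (h : IsHalvingSystem x y E) {p : ι × ι} (hp : p ∈ E) :
    p.1 ≠ p.2 := by
  intro he
  have : p.swap = p := Prod.ext he.symm he
  exact h.asymm p hp (this ▸ hp)

lemma IsHalvingSystem.reindex (h : IsHalvingSystem x y E) (e : κ ≃ ι) :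
    IsHalvingSystem (x ∘ e) (y ∘ e) (E.map (e.symm.prodCongr e.symm).toEmbedding) where
  inj := h.inj.comp e.injective
  genPos i j l hij hil hjl :=
    h.genPos _ _ _ (e.injective.ne hij) (e.injective.ne hil) (e.injective.ne hjl)
  halving p hp := by
    obtain ⟨q, hq, rfl⟩ := Finset.mem_map.1 hp
    rw [← h.halving q hq, ← e.sum_comp]
    simp [orient]
  asymm p hp hs := by
    obtain ⟨q, hq, rfl⟩ := Finset.mem_map.1 hp
    obtain ⟨r, hr, hrq⟩ := Finset.mem_map.1 hs
    have : r = q.swap := by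
      simp only [Equiv.coe_toEmbedding, Equiv.prodCongr_apply, Prod.ext_iff, Prod.map_fst,
        Prod.map_snd, Prod.fst_swap, Prod.snd_swap, e.symm.injective.eq_iff] at hrq ⊢
      exact hrq
    exact h.asymm q hq (this ▸ hr)

lemma IsHalvingSystem.sub_const (h : IsHalvingSystem x y E) (c : ℝ) :
    IsHalvingSystem (fun i => x i - c) y E where
  inj i j hij := h.inj (sub_left_injective hij)
  genPos i j l := by simpa [orient] using h.genPos i j l
  halving p hp := by simpa [orient] using h.halving p hp
  asymm := h.asymm

end reindex

lemma isgn_sub_rev {N : ℕ} {x : Fin N → ℝ} (hx : StrictMono x) (s r : Fin N) :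
    isgn (x s.rev - x r.rev) = -isgn (x s - x r) := by
  rcases lt_trichotomy s r with h | rfl | h
  · rw [isgn_pos (sub_pos.2 (hx (Fin.rev_lt_rev.2 h))), isgn_of_neg (sub_neg.2 (hx h)), neg_neg]
  · simp [isgn_zero]
  · rw [isgn_of_neg (sub_neg.2 (hx (Fin.rev_lt_rev.2 h))), isgn_pos (sub_pos.2 (hx h))]

lemma sum_isgn_sub_rev {N : ℕ} {x : Fin N → ℝ} (hx : StrictMono x) (s : Fin N) :
    ∑ r, isgn (x s.rev - x r) = -∑ r, isgn (x s - x r) := by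
  rw [← Equiv.sum_comp Fin.revPerm, ← Finset.sum_neg_distrib]
  exact Finset.sum_congr rfl fun r _ => isgn_sub_rev hx s r

/-- A strictly increasing sequence of even length can be cut into two halves of equal size. -/
lemma exists_balanced_cut {N : ℕ} {x : Fin N → ℝ} (hx : StrictMono x) :
    ∃ c, (∀ i, x i ≠ c) ∧ (Even N → ∑ i, isgn (x i - c) = 0) := by
  by_cases hN : Even N ∧ 0 < N
  · obtain ⟨⟨m, rfl⟩, hm⟩ := hN
    let a : Fin (m + m) := ⟨m - 1, by omega⟩
    let b : Fin (m + m) := ⟨m, by omega⟩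
    have hab : x a < x b := hx (Fin.mk_lt_mk.2 (by omega))
    have hlo : ∀ i : Fin (m + m), i.val < m → x i - (x a + x b) / 2 < 0 := by
      intro i hi
      have : x i ≤ x a := hx.monotone (Fin.mk_le_mk.2 (by omega))
      linarith
    have hhi : ∀ i : Fin (m + m), m ≤ i.val → 0 < x i - (x a + x b) / 2 := by
      intro i hi
      have : x b ≤ x i := hx.monotone (Fin.mk_le_mk.2 hi)
      linarith
    refine ⟨(x a + x b) / 2, fun i hi => ?_, fun _ => ?_⟩
    · rcases lt_or_ge i.val m with h | h
      · linarith [hlo i h]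
      · linarith [hhi i h]
    · have hrev : ∀ i : Fin (m + m), isgn (x i.rev - (x a + x b) / 2) =
          -isgn (x i - (x a + x b) / 2) := by
        intro i
        have hr := Fin.val_rev i
        rcases lt_or_ge i.val m with h | h
        · rw [isgn_of_neg (hlo i h), isgn_pos (hhi _ (by omega)), neg_neg]
        · rw [isgn_pos (hhi i h), isgn_of_neg (hlo _ (by omega))]
      have hsum := Equiv.sum_comp Fin.revPerm fun i => isgn (x i - (x a + x b) / 2)
      simp only [Fin.revPerm_apply, hrev, Finset.sum_neg_distrib] at hsum
      omega
  · obtain ⟨c, hc⟩ := (Set.finite_range x).infinite_compl.nonempty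
    refine ⟨c, fun i hi => hc ⟨i, hi⟩, fun he => ?_⟩
    obtain rfl : N = 0 := by
      by_contra h
      exact hN ⟨he, Nat.pos_of_ne_zero h⟩
    simp

section blowUp

variable {V ι : Type*}

/-- First coordinate of the point of index `p.2` in the cluster at the vertex `p.1`: the cluster
is a flattened copy of the family `(x, y)`, directed from `p.1` to `f p.1`. -/
def blowUpX (a b : V → ℝ) (f : V → V) (x y : ι → ℝ) (ε : ℝ) (p : V × ι) : ℝ :=
  a p.1 + ε * x p.2 * (a (f p.1) - a p.1) - ε ^ 3 * y p.2 * (b (f p.1) - b p.1)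

/-- Second coordinate of the point of index `p.2` in the cluster at the vertex `p.1`. -/
def blowUpY (a b : V → ℝ) (f : V → V) (x y : ι → ℝ) (ε : ℝ) (p : V × ι) : ℝ :=
  b p.1 + ε * x p.2 * (b (f p.1) - b p.1) + ε ^ 3 * y p.2 * (a (f p.1) - a p.1)

variable {a b : V → ℝ} {f : V → V} {x y : ι → ℝ}

lemma eventually_blowUpX_ne (ha : Injective a) (hf : ∀ v, f v ≠ v) (hx : Injective x)
    {p q : V × ι} (hpq : p ≠ q) :
    ∀ᶠ ε in 𝓝[>] (0 : ℝ), blowUpX a b f x y ε p ≠ blowUpX a b f x y ε q := by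
  obtain ⟨v, s⟩ := p
  obtain ⟨w, t⟩ := q
  suffices H : ∀ᶠ ε in 𝓝[>] (0 : ℝ),
      isgn (blowUpX a b f x y ε (v, s) - blowUpX a b f x y ε (w, t)) ≠ 0 by
    filter_upwards [H] with ε hε he
    exact hε (by rw [he, sub_self, isgn_zero])
  by_cases hvw : v = w
  · subst hvw
    have hst : x s ≠ x t := hx.ne fun h => hpq (by rw [h])
    have h0 : (x s - x t) * (a (f v) - a v) ≠ 0 :=
      mul_ne_zero (sub_ne_zero.2 hst) (sub_ne_zero.2 (ha.ne (hf v)))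
    filter_upwards [eventually_isgn_eq
      (g := fun ε => blowUpX a b f x y ε (v, s) - blowUpX a b f x y ε (v, t))
      (h := fun ε => (x s - x t) * (a (f v) - a v) - ε ^ 2 * (y s - y t) * (b (f v) - b v)) 1
      (fun ε => by simp only [blowUpX]; ring) (by fun_prop) (by simpa using h0)] with ε hε
    rw [hε, Ne, isgn_eq_zero]
    simpa using h0
  · have h0 : a v - a w ≠ 0 := sub_ne_zero.2 (ha.ne hvw)
    filter_upwards [eventually_isgn_eq
      (g := fun ε => blowUpX a b f x y ε (v, s) - blowUpX a b f x y ε (w, t))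
      (h := fun ε => blowUpX a b f x y ε (v, s) - blowUpX a b f x y ε (w, t)) 0
      (fun ε => by simp) (by unfold blowUpX; fun_prop) (by simpa [blowUpX] using h0)] with ε hε
    rw [hε, Ne, isgn_eq_zero]
    simpa [blowUpX] using h0

lemma eventually_isgn_orient_of_ne {v w u : V} (h : orient a b v w u ≠ 0) (s t r : ι) :
    ∀ᶠ ε in 𝓝[>] (0 : ℝ), isgn (orient (blowUpX a b f x y ε) (blowUpY a b f x y ε)
      (v, s) (w, t) (u, r)) = isgn (orient a b v w u) := by
  have h0 : orient (blowUpX a b f x y 0) (blowUpY a b f x y 0) (v, s) (w, t) (u, r) =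
      orient a b v w u := by simp [orient, blowUpX, blowUpY]
  rw [← h0] at h ⊢
  exact eventually_isgn_eq
    (h := fun ε => orient (blowUpX a b f x y ε) (blowUpY a b f x y ε) (v, s) (w, t) (u, r)) 0
    (fun ε => by simp) (by unfold orient blowUpX blowUpY; fun_prop) h

lemma eventually_isgn_orient_of_ne_target {v u : V} (h : orient a b v (f v) u ≠ 0) {s t : ι}
    (hst : x s ≠ x t) (r : ι) :
    ∀ᶠ ε in 𝓝[>] (0 : ℝ), isgn (orient (blowUpX a b f x y ε) (blowUpY a b f x y ε)
      (v, s) (v, t) (u, r)) = isgn ((x t - x s) * orient a b v (f v) u) := by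
  let h' : ℝ → ℝ := fun ε =>
    ((x t - x s) * (a (f v) - a v) - ε ^ 2 * (y t - y s) * (b (f v) - b v)) *
      (blowUpY a b f x y ε (u, r) - blowUpY a b f x y ε (v, s)) -
    ((x t - x s) * (b (f v) - b v) + ε ^ 2 * (y t - y s) * (a (f v) - a v)) *
      (blowUpX a b f x y ε (u, r) - blowUpX a b f x y ε (v, s))
  have h0 : h' 0 = (x t - x s) * orient a b v (f v) u := by
    simp only [h', orient, blowUpX, blowUpY]; ring
  rw [← h0]
  refine eventually_isgn_eq 1 (fun ε => ?_) (by unfold h' blowUpX blowUpY; fun_prop) ?_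
  · simp only [h', orient, blowUpX, blowUpY]; ring
  · rw [h0]
    exact mul_ne_zero (sub_ne_zero.2 hst.symm) h

lemma eventually_isgn_orient_target {v : V} (h : orient a b v (f v) (f (f v)) ≠ 0) {s t r : ι}
    (hst : x s ≠ x t) (hr : x r ≠ 0) :
    ∀ᶠ ε in 𝓝[>] (0 : ℝ), isgn (orient (blowUpX a b f x y ε) (blowUpY a b f x y ε)
      (v, s) (v, t) (f v, r)) = isgn ((x t - x s) * x r * orient a b v (f v) (f (f v))) := by
  let h' : ℝ → ℝ := fun ε =>
    (x t - x s) * (a (f v) - a v) *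
      (x r * (b (f (f v)) - b (f v)) +
        ε ^ 2 * (y r * (a (f (f v)) - a (f v)) - y s * (a (f v) - a v))) -
    (x t - x s) * (b (f v) - b v) *
      (x r * (a (f (f v)) - a (f v)) -
        ε ^ 2 * (y r * (b (f (f v)) - b (f v)) - y s * (b (f v) - b v))) -
    ε * (y t - y s) * ((b (f v) - b v) *
      (blowUpY a b f x y ε (f v, r) - blowUpY a b f x y ε (v, s)) +
      (a (f v) - a v) * (blowUpX a b f x y ε (f v, r) - blowUpX a b f x y ε (v, s)))
  have h0 : h' 0 = (x t - x s) * x r * orient a b v (f v) (f (f v)) := by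
    simp only [h', orient, blowUpX, blowUpY]; ring
  rw [← h0]
  refine eventually_isgn_eq 2 (fun ε => ?_) (by unfold h' blowUpX blowUpY; fun_prop) ?_
  · simp only [h', orient, blowUpX, blowUpY]; ring
  · rw [h0]
    exact mul_ne_zero (mul_ne_zero (sub_ne_zero.2 hst.symm) hr) h

lemma eventually_isgn_orient_same (ha : Injective a) (hf : ∀ v, f v ≠ v) (v : V) {s t r : ι}
    (h : orient x y s t r ≠ 0) :
    ∀ᶠ ε in 𝓝[>] (0 : ℝ), isgn (orient (blowUpX a b f x y ε) (blowUpY a b f x y ε)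
      (v, s) (v, t) (v, r)) = isgn (orient x y s t r) := by
  have hd : 0 < (a (f v) - a v) ^ 2 + (b (f v) - b v) ^ 2 := by
    have := sub_ne_zero.2 (ha.ne (hf v))
    positivity
  have h1 : isgn (orient x y s t r) =
      isgn (((a (f v) - a v) ^ 2 + (b (f v) - b v) ^ 2) * orient x y s t r) := by
    rw [isgn_mul, isgn_pos hd, one_mul]
  rw [h1]
  refine eventually_isgn_eq
    (h := fun _ => ((a (f v) - a v) ^ 2 + (b (f v) - b v) ^ 2) * orient x y s t r) 4
    (fun ε => ?_) continuous_const (mul_ne_zero hd.ne' h)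
  simp only [orient, blowUpX, blowUpY]; ring

end blowUp

/-- The sign pattern of the blown up family for all small positive values of the parameter. -/
structure IsGoodBlowUp {V ι : Type*} (a b : V → ℝ) (f : V → V) (x y : ι → ℝ)
    (X Y : V × ι → ℝ) : Prop where
  inj : Injective X
  distinct : ∀ v w u s t r, v ≠ w → v ≠ u → w ≠ u →
    isgn (orient X Y (v, s) (w, t) (u, r)) = isgn (orient a b v w u)
  off_target : ∀ v u s t r, u ≠ v → u ≠ f v →
    isgn (orient X Y (v, s) (v, t) (u, r)) = isgn ((x t - x s) * orient a b v (f v) u)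
  target : ∀ v s t r, isgn (orient X Y (v, s) (v, t) (f v, r)) =
    isgn ((x t - x s) * x r * orient a b v (f v) (f (f v)))
  same : ∀ v s t r, isgn (orient X Y (v, s) (v, t) (v, r)) = isgn (orient x y s t r)

lemma exists_isGoodBlowUp {V ι : Type*} [Finite V] [Finite ι] {a b : V → ℝ} {f : V → V}
    {x y : ι → ℝ} (ha : Injective a) (hab : ∀ v w u, v ≠ w → v ≠ u → w ≠ u → orient a b v w u ≠ 0)
    (hf : ∀ v, f v ≠ v) (hff : ∀ v, f (f v) ≠ v) (hx : Injective x) (hx0 : ∀ i, x i ≠ 0)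
    (hxy : ∀ i j l, i ≠ j → i ≠ l → j ≠ l → orient x y i j l ≠ 0) :
    ∃ X Y : V × ι → ℝ, IsGoodBlowUp a b f x y X Y := by
  have h1 : ∀ᶠ ε in 𝓝[>] (0 : ℝ), ∀ p q, p ≠ q →
      blowUpX a b f x y ε p ≠ blowUpX a b f x y ε q := by
    simp only [eventually_all]
    exact fun p q hpq => eventually_blowUpX_ne ha hf hx hpq
  have h2 : ∀ᶠ ε in 𝓝[>] (0 : ℝ), ∀ v w u s t r, v ≠ w → v ≠ u → w ≠ u →
      isgn (orient (blowUpX a b f x y ε) (blowUpY a b f x y ε) (v, s) (w, t) (u, r)) =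
        isgn (orient a b v w u) := by
    simp only [eventually_all]
    exact fun v w u s t r hvw hvu hwu => eventually_isgn_orient_of_ne (hab v w u hvw hvu hwu) s t r
  have h3 : ∀ᶠ ε in 𝓝[>] (0 : ℝ), ∀ v u s t r, u ≠ v → u ≠ f v →
      isgn (orient (blowUpX a b f x y ε) (blowUpY a b f x y ε) (v, s) (v, t) (u, r)) =
        isgn ((x t - x s) * orient a b v (f v) u) := by
    simp only [eventually_all]
    intro v u s t r huv huf
    by_cases hst : s = t
    · subst hst
      simp [orient_self_left]
    · exact eventually_isgn_orient_of_ne_target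
        (hab _ _ _ (hf v).symm huv.symm huf.symm) (hx.ne hst) r
  have h4 : ∀ᶠ ε in 𝓝[>] (0 : ℝ), ∀ v s t r,
      isgn (orient (blowUpX a b f x y ε) (blowUpY a b f x y ε) (v, s) (v, t) (f v, r)) =
        isgn ((x t - x s) * x r * orient a b v (f v) (f (f v))) := by
    simp only [eventually_all]
    intro v s t r
    by_cases hst : s = t
    · subst hst
      simp [orient_self_left]
    · exact eventually_isgn_orient_target
        (hab _ _ _ (hf v).symm (hff v).symm (hf (f v)).symm) (hx.ne hst) (hx0 r)
  have h5 : ∀ᶠ ε in 𝓝[>] (0 : ℝ), ∀ v s t r,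
      isgn (orient (blowUpX a b f x y ε) (blowUpY a b f x y ε) (v, s) (v, t) (v, r)) =
        isgn (orient x y s t r) := by
    simp only [eventually_all]
    intro v s t r
    by_cases hst : s = t
    · subst hst
      simp [orient_self_left]
    by_cases hsr : s = r
    · subst hsr
      simp [orient_self_outer]
    by_cases htr : t = r
    · subst htr
      simp [orient_self_right]
    exact eventually_isgn_orient_same ha hf v (hxy s t r hst hsr htr)
  obtain ⟨ε, h1, h2, h3, h4, h5⟩ := (h1.and (h2.and (h3.and (h4.and h5)))).exists
  exact ⟨_, _, fun p q hpq => by_contra fun h => h1 p q h hpq, h2, h3, h4, h5⟩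

namespace IsGoodBlowUp

variable {V ι : Type*} {a b : V → ℝ} {f : V → V} {x y : ι → ℝ} {X Y : V × ι → ℝ}

lemma orient_ne_zero_of_fst_eq (H : IsGoodBlowUp a b f x y X Y)
    (hab : ∀ v w u, v ≠ w → v ≠ u → w ≠ u → orient a b v w u ≠ 0)
    (hf : ∀ v, f v ≠ v) (hff : ∀ v, f (f v) ≠ v) (hx : Injective x) (hx0 : ∀ i, x i ≠ 0)
    {v u : V} {s t : ι} (r : ι) (huv : u ≠ v) (hst : s ≠ t) :
    orient X Y (v, s) (v, t) (u, r) ≠ 0 := by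
  have hxst : x t - x s ≠ 0 := sub_ne_zero.2 (hx.ne hst.symm)
  rw [Ne, ← isgn_eq_zero]
  by_cases huf : u = f v
  · subst huf
    rw [H.target, isgn_eq_zero]
    exact mul_ne_zero (mul_ne_zero hxst (hx0 r))
      (hab _ _ _ (hf v).symm (hff v).symm (hf (f v)).symm)
  · rw [H.off_target _ _ _ _ _ huv huf, isgn_eq_zero]
    exact mul_ne_zero hxst (hab _ _ _ (hf v).symm huv.symm (Ne.symm huf))

lemma orient_ne_zero (H : IsGoodBlowUp a b f x y X Y)
    (hab : ∀ v w u, v ≠ w → v ≠ u → w ≠ u → orient a b v w u ≠ 0)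
    (hf : ∀ v, f v ≠ v) (hff : ∀ v, f (f v) ≠ v) (hx : Injective x) (hx0 : ∀ i, x i ≠ 0)
    (hxy : ∀ i j l, i ≠ j → i ≠ l → j ≠ l → orient x y i j l ≠ 0)
    (p q z : V × ι) (hpq : p ≠ q) (hpz : p ≠ z) (hqz : q ≠ z) : orient X Y p q z ≠ 0 := by
  obtain ⟨v, s⟩ := p
  obtain ⟨w, t⟩ := q
  obtain ⟨u, r⟩ := z
  have key : ∀ {v u : V} {s t : ι} (r : ι), u ≠ v → s ≠ t →
      orient X Y (v, s) (v, t) (u, r) ≠ 0 := H.orient_ne_zero_of_fst_eq hab hf hff hx hx0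
  simp only [ne_eq, Prod.mk.injEq, not_and] at hpq hpz hqz
  by_cases hvw : v = w
  · subst hvw
    by_cases hvu : v = u
    · subst hvu
      rw [Ne, ← isgn_eq_zero, H.same, isgn_eq_zero]
      exact hxy _ _ _ (hpq rfl) (hpz rfl) (hqz rfl)
    · exact key r (Ne.symm hvu) (hpq rfl)
  by_cases hvu : v = u
  · subst hvu
    rw [orient_rotate, orient_rotate]
    exact key t (Ne.symm hvw) (Ne.symm (hpz rfl))
  by_cases hwu : w = u
  · subst hwu
    rw [orient_rotate]
    exact key s hvw (hqz rfl)
  · rw [Ne, ← isgn_eq_zero, H.distinct _ _ _ _ _ _ hvw hvu hwu, isgn_eq_zero]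
    exact hab _ _ _ hvw hvu hwu

variable [Fintype V] [Fintype ι]

lemma sum_isgn_inner (H : IsGoodBlowUp a b f x y X Y) (hf : ∀ v, f v ≠ v)
    (hh : ∀ v, ∑ u, isgn (orient a b v (f v) u) = 0) (hx : ∑ r, isgn (x r) = 0)
    (v : V) {s t : ι} (hst : ∑ r, isgn (orient x y s t r) = 0) :
    ∑ z, isgn (orient X Y (v, s) (v, t) z) = 0 := by
  classical
  have key : ∀ u r, isgn (orient X Y (v, s) (v, t) (u, r)) =
      isgn (x t - x s) * isgn (orient a b v (f v) u) +
      (if u = v then isgn (orient x y s t r) else 0) +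
      (if u = f v then isgn (x t - x s) * isgn (orient a b v (f v) (f (f v))) * isgn (x r)
        else 0) := by
    intro u r
    by_cases huv : u = v
    · subst huv
      simp [H.same, orient_self_outer, isgn_zero, (hf u).symm]
    by_cases huf : u = f v
    · subst huf
      simp [H.target, orient_self_right, isgn_zero, huv, isgn_mul, mul_right_comm]
    · simp [H.off_target _ _ _ _ _ huv huf, huv, huf, isgn_mul]
  rw [Fintype.sum_prod_type]
  simp only [key, Finset.sum_add_distrib, Finset.sum_const, Finset.sum_ite_irrel, hst,
    ← Finset.mul_sum, hx]
  simp [← Finset.mul_sum, hh]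

lemma sum_isgn_cross (H : IsGoodBlowUp a b f x y X Y) (hf : ∀ v, f v ≠ v)
    (hh : ∀ v, ∑ u, isgn (orient a b v (f v) u) = 0) (hff : ∀ v, f (f v) ≠ v)
    (v : V) {s t : ι} (hst : isgn (x t) * ∑ r, isgn (x s - x r) = ∑ r, isgn (x t - x r)) :
    ∑ z, isgn (orient X Y (v, s) (f v, t) z) = 0 := by
  classical
  have key : ∀ u r, isgn (orient X Y (v, s) (f v, t) (u, r)) =
      isgn (orient a b v (f v) u) +
      (if u = v then isgn (orient a b v (f v) (f (f v))) * (isgn (x t) * isgn (x s - x r))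
        else 0) +
      (if u = f v then isgn (orient a b v (f v) (f (f v))) * -isgn (x t - x r) else 0) := by
    intro u r
    by_cases huv : u = v
    · subst huv
      rw [orient_rotate, orient_rotate, H.target]
      simp only [orient_self_outer, isgn_zero, (hf u).symm, if_true, if_false, isgn_mul]
      ring
    by_cases huf : u = f v
    · subst huf
      rw [orient_rotate, H.off_target _ _ _ _ _ (hf v).symm (hff v).symm,
        ← orient_rotate, isgn_mul, isgn_sub_comm (x r)]
      simp only [orient_self_right, isgn_zero, huv, if_true, if_false]
      ring
    · simp [H.distinct _ _ _ _ _ _ (hf v).symm (Ne.symm huv) (Ne.symm huf), huv, huf]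
  rw [Fintype.sum_prod_type]
  simp only [key, Finset.sum_add_distrib, Finset.sum_const, Finset.sum_ite_irrel,
    ← Finset.mul_sum, Finset.sum_neg_distrib, hst]
  simp [← Finset.mul_sum, hh]

end IsGoodBlowUp

/-- Sorting by the first coordinate and cutting in the middle. -/
lemma IsHalvingSystem.exists_sorted {N : ℕ} {x y : Fin N → ℝ} {E : Finset (Fin N × Fin N)}
    (h : IsHalvingSystem x y E) :
    ∃ (x' y' : Fin N → ℝ) (E' : Finset (Fin N × Fin N)), IsHalvingSystem x' y' E' ∧
      StrictMono x' ∧ (∀ i, x' i ≠ 0) ∧ (Even N → ∑ i, isgn (x' i) = 0) ∧ E'.card = E.card := by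
  have hm : StrictMono (x ∘ Tuple.sort x) :=
    (Tuple.monotone_sort x).strictMono_of_injective (h.inj.comp (Tuple.sort x).injective)
  obtain ⟨c, hc, hb⟩ := exists_balanced_cut hm
  exact ⟨_, _, _, (h.reindex (Tuple.sort x)).sub_const c,
    fun i j hij => sub_lt_sub_right (hm hij) c, fun i => sub_ne_zero.2 (hc i), hb,
    Finset.card_map _⟩

/-- Replacing each vertex `v` of a configuration by a flattened halving system directed along
the halving edge from `v` to `f v`. -/
lemma IsHalvingSystem.blowUp {M N : ℕ} {a b : Fin M → ℝ} {f : Fin M → Fin M} (ha : Injective a)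
    (hab : ∀ v w u, v ≠ w → v ≠ u → w ≠ u → orient a b v w u ≠ 0)
    (hf : ∀ v, f v ≠ v) (hff : ∀ v, f (f v) ≠ v)
    (hh : ∀ v, ∑ u, isgn (orient a b v (f v) u) = 0)
    {x y : Fin N → ℝ} {E : Finset (Fin N × Fin N)} (h : IsHalvingSystem x y E)
    (hE : E.Nonempty → Even N) :
    ∃ (x' y' : Fin (M * N) → ℝ) (E' : Finset (Fin (M * N) × Fin (M * N))),
      IsHalvingSystem x' y' E' ∧ E'.card = M * E.card + M * N := by
  classical
  obtain ⟨x, y, E', h, hmono, hx0, hbal, hcard⟩ := h.exists_sorted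
  have hE' : E'.Nonempty → ∑ i, isgn (x i) = 0 := fun hne =>
    hbal (hE (Finset.card_pos.1 (hcard ▸ Finset.card_pos.2 hne)))
  rw [← hcard]
  obtain ⟨X, Y, H⟩ := exists_isGoodBlowUp ha hab hf hff h.inj hx0 h.genPos
  let τ : Fin N → Fin N := fun t => if 0 < x t then t else t.rev
  let inner : Fin M × (Fin N × Fin N) ↪ (Fin M × Fin N) × (Fin M × Fin N) :=
    ⟨fun q => ((q.1, q.2.1), (q.1, q.2.2)), by
      rintro ⟨v, s, t⟩ ⟨w, s', t'⟩ hq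
      simp only [Prod.mk.injEq] at hq ⊢
      tauto⟩
  let cross : Fin M × Fin N ↪ (Fin M × Fin N) × (Fin M × Fin N) :=
    ⟨fun q => ((q.1, τ q.2), (f q.1, q.2)), by
      rintro ⟨v, s⟩ ⟨w, t⟩ hq
      simp only [Prod.mk.injEq] at hq ⊢
      tauto⟩
  have hinner : ∀ v s t, inner (v, s, t) = ((v, s), (v, t)) := fun _ _ _ => rfl
  have hcross : ∀ v t, cross (v, t) = ((v, τ t), (f v, t)) := fun _ _ => rfl
  have hdisj : Disjoint ((Finset.univ ×ˢ E').map inner) (Finset.univ.map cross) := by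
    rw [Finset.disjoint_left]
    intro p hp hq
    obtain ⟨⟨v, s, t⟩, -, rfl⟩ := Finset.mem_map.1 hp
    obtain ⟨⟨w, r⟩, -, hr⟩ := Finset.mem_map.1 hq
    simp only [hinner, hcross, Prod.mk.injEq] at hr
    exact hf w (hr.2.1.trans hr.1.1.symm)
  have hsys : IsHalvingSystem X Y
      (((Finset.univ ×ˢ E').map inner).disjUnion (Finset.univ.map cross) hdisj) := by
    refine ⟨H.inj, H.orient_ne_zero hab hf hff h.inj hx0 h.genPos, fun p hp => ?_,
      fun p hp hs => ?_⟩
    · rcases Finset.mem_disjUnion.1 hp with hp | hp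
      · obtain ⟨⟨v, s, t⟩, hq, rfl⟩ := Finset.mem_map.1 hp
        have hst := (Finset.mem_product.1 hq).2
        exact H.sum_isgn_inner hf hh (hE' ⟨_, hst⟩) v (h.halving _ hst)
      · obtain ⟨⟨v, t⟩, -, rfl⟩ := Finset.mem_map.1 hp
        refine H.sum_isgn_cross hf hh hff v ?_
        rcases lt_or_gt_of_ne (hx0 t) with ht | ht
        · simp only [τ, if_neg ht.not_gt, isgn_of_neg ht, sum_isgn_sub_rev hmono]
          ring
        · simp only [τ, if_pos ht, isgn_pos ht, one_mul]
    · rcases Finset.mem_disjUnion.1 hp with hp | hp <;>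
        rcases Finset.mem_disjUnion.1 hs with hs | hs
      · obtain ⟨⟨v, s, t⟩, hq, rfl⟩ := Finset.mem_map.1 hp
        obtain ⟨⟨w, s', t'⟩, hq', he⟩ := Finset.mem_map.1 hs
        simp only [hinner, Prod.swap_prod_mk, Prod.mk.injEq] at he
        obtain ⟨⟨-, rfl⟩, -, rfl⟩ := he
        exact h.asymm _ (Finset.mem_product.1 hq).2 (Finset.mem_product.1 hq').2
      · obtain ⟨⟨v, s, t⟩, -, rfl⟩ := Finset.mem_map.1 hp
        obtain ⟨⟨w, r⟩, -, he⟩ := Finset.mem_map.1 hs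
        simp only [hinner, hcross, Prod.swap_prod_mk, Prod.mk.injEq] at he
        exact hf w (he.2.1.trans he.1.1.symm)
      · obtain ⟨⟨v, s⟩, -, rfl⟩ := Finset.mem_map.1 hp
        obtain ⟨⟨w, s', t'⟩, -, he⟩ := Finset.mem_map.1 hs
        simp only [hinner, hcross, Prod.swap_prod_mk, Prod.mk.injEq] at he
        exact hf v (he.1.1.symm.trans he.2.1)
      · obtain ⟨⟨v, s⟩, -, rfl⟩ := Finset.mem_map.1 hp
        obtain ⟨⟨w, t⟩, -, he⟩ := Finset.mem_map.1 hs
        simp only [hcross, Prod.swap_prod_mk, Prod.mk.injEq] at he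
        exact hff v (he.1.1 ▸ he.2.1)
  refine ⟨_, _, _, hsys.reindex finProdFinEquiv.symm, ?_⟩
  rw [Finset.card_map, Finset.card_disjUnion, Finset.card_map, Finset.card_map]
  simp

/-- First coordinates of a six-point configuration with six halving edges. -/
def sixX : Fin 6 → ℤ := ![1, 0, 4, 2, -6, 8]

/-- Second coordinates of a six-point configuration with six halving edges. -/
def sixY : Fin 6 → ℤ := ![1, -1, -2, 6, -7, -4]

/-- A choice of a halving edge at each of the six points. -/
def sixNext : Fin 6 → Fin 6 := ![1, 2, 0, 0, 1, 2]

lemma orient_six (v w u : Fin 6) :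
    orient (fun i => (sixX i : ℝ)) (fun i => (sixY i : ℝ)) v w u =
      (((sixX w - sixX v) * (sixY u - sixY v) -
        (sixY w - sixY v) * (sixX u - sixX v) : ℤ) : ℝ) := by
  simp [orient]

lemma exists_isHalvingSystem_six_pow (k : ℕ) :
    ∃ (x y : Fin (6 ^ k) → ℝ) (E : Finset (Fin (6 ^ k) × Fin (6 ^ k))),
      IsHalvingSystem x y E ∧ E.card = k * 6 ^ k := by
  induction k with
  | zero =>
    have : Subsingleton (Fin (6 ^ 0)) := by rw [pow_zero]; infer_instance
    exact ⟨0, 0, ∅, ⟨injective_of_subsingleton _,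
      fun i j _ hij => absurd (Subsingleton.elim i j) hij, by simp, by simp⟩, by simp⟩
  | succ k ih =>
    obtain ⟨x, y, E, h, hE⟩ := ih
    have hne : E.Nonempty → Even (6 ^ k) := by
      intro hne
      refine Even.pow_of_ne_zero (by decide) ?_
      rintro rfl
      simp [hne.ne_empty] at hE
    obtain ⟨x', y', E', h', hE'⟩ := IsHalvingSystem.blowUp
      (a := fun i => (sixX i : ℝ)) (b := fun i => (sixY i : ℝ)) (f := sixNext)
      (fun i j hij => by
        have h6 : Injective sixX := by decide
        exact h6 (Int.cast_injective (α := ℝ) hij))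
      (fun v w u => by
        rw [orient_six, Ne, Ne, Ne, Ne, Int.cast_eq_zero]
        revert v w u; decide)
      (by decide) (by decide)
      (fun v => by
        simp only [orient_six, isgn_intCast]
        revert v; decide) h hne
    have hpow : 6 * 6 ^ k = 6 ^ (k + 1) := by ring
    rw [← hpow]
    exact ⟨x', y', E', h', by rw [hE', hE]; ring⟩

section realize

variable {n : ℕ} (x y : Fin n → ℝ)

lemma det2_mk (i j l : Fin n) :
    det2 !₂[x i, y i] !₂[x j, y j] !₂[x l, y l] = orient x y i j l := by
  simp [det2, orient]

/-- Collinear points have vanishing determinant. -/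
lemma det2_eq_zero_of_collinear {p q r : Pt} (h : Collinear ℝ ({p, q, r} : Set Pt)) :
    det2 p q r = 0 := by
  obtain ⟨v, hv⟩ := (collinear_iff_of_mem (p₀ := p) (by simp)).1 h
  obtain ⟨s, hs⟩ := hv q (by simp)
  obtain ⟨t, ht⟩ := hv r (by simp)
  rw [hs, ht]
  simp [det2]
  ring

lemma sum_isgn_eq {ι : Type*} [Fintype ι] (g : ι → ℝ) :
    ∑ i, isgn (g i) = ((Finset.univ.filter fun i => 0 < g i).card : ℤ) -
      (Finset.univ.filter fun i => g i < 0).card := by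
  simp only [Finset.card_filter, Nat.cast_sum, ← Finset.sum_sub_distrib]
  refine Finset.sum_congr rfl fun i _ => ?_
  rcases lt_trichotomy (g i) 0 with h | h | h
  · simp [isgn_of_neg h, h, h.not_gt]
  · simp [h, isgn_zero]
  · simp [isgn_pos h, h, h.not_gt]

end realize

lemma IsHalvingSystem.exists_finset {n : ℕ} {x y : Fin n → ℝ} {E : Finset (Fin n × Fin n)}
    (h : IsHalvingSystem x y E) :
    ∃ S : Finset Pt, GenPos S ∧ S.card = n ∧ E.card ≤ halvingEdgeCount S := by
  classical
  let P : Fin n → Pt := fun i => !₂[x i, y i]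
  have hP : Injective P := fun i j hij => h.inj (by simpa [P] using congrArg (fun p : Pt => p 0) hij)
  have hdet : ∀ i j l, det2 (P i) (P j) (P l) = orient x y i j l := det2_mk x y
  have hcard : (Finset.univ.image P).card = n := by
    rw [Finset.card_image_of_injective _ hP, Finset.card_univ, Fintype.card_fin]
  have hncard : ∀ Q : Pt → Prop, {r ∈ ((Finset.univ.image P : Finset Pt) : Set Pt) | Q r}.ncard =
      (Finset.univ.filter fun l => Q (P l)).card := by
    intro Q
    rw [← Finset.card_image_of_injective _ hP, ← Set.ncard_coe_finset]
    congr 1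
    ext r
    simp only [Finset.coe_image, Finset.coe_univ, Set.image_univ, Set.mem_range, Set.mem_ofPred_eq,
      Finset.coe_filter, Finset.mem_univ, true_and, Set.mem_image]
    constructor
    · rintro ⟨⟨i, rfl⟩, hi⟩
      exact ⟨i, hi, rfl⟩
    · rintro ⟨i, hi, rfl⟩
      exact ⟨⟨i, rfl⟩, hi⟩
  have hhalf : ∀ p ∈ E, HalvingEdge (Finset.univ.image P) (P p.1) (P p.2) := by
    intro p hp
    have hne := h.ne hp
    have hsum := h.halving p hp
    rw [sum_isgn_eq] at hsum
    have hzero : (Finset.univ.filter fun l => orient x y p.1 p.2 l = 0) = {p.1, p.2} := by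
      ext l
      simp only [Finset.mem_filter, Finset.mem_univ, true_and, Finset.mem_insert,
        Finset.mem_singleton]
      constructor
      · intro hl
        by_contra! hc
        exact h.genPos _ _ _ hne hc.1.symm hc.2.symm hl
      · rintro (rfl | rfl)
        · exact orient_self_outer _ _ _ _
        · exact orient_self_right _ _ _ _
    have htot : (Finset.univ.filter fun l => 0 < orient x y p.1 p.2 l).card +
        (Finset.univ.filter fun l => orient x y p.1 p.2 l < 0).card +
        (Finset.univ.filter fun l => orient x y p.1 p.2 l = 0).card = n := by
      conv_rhs => rw [← Fintype.card_fin n, ← Finset.card_univ, Finset.card_eq_sum_ones]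
      simp only [Finset.card_filter, ← Finset.sum_add_distrib]
      refine Finset.sum_congr rfl fun l _ => ?_
      rcases lt_trichotomy (orient x y p.1 p.2 l) 0 with h | h | h
      · simp [h, h.not_gt, h.ne]
      · simp [h]
      · simp [h, h.not_gt, h.ne']
    rw [hzero, Finset.card_pair hne] at htot
    refine ⟨Finset.mem_image_of_mem _ (Finset.mem_univ _),
      Finset.mem_image_of_mem _ (Finset.mem_univ _), hP.ne hne, ?_, ?_⟩
    · rw [hncard, hcard]
      simp only [hdet]
      omega
    · rw [hncard, hcard]
      simp only [hdet]
      omega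
  refine ⟨Finset.univ.image P, ?_, hcard, ?_⟩
  · intro p hp q hq r hr hpq hpr hqr hc
    obtain ⟨i, -, rfl⟩ := Finset.mem_image.1 hp
    obtain ⟨j, -, rfl⟩ := Finset.mem_image.1 hq
    obtain ⟨l, -, rfl⟩ := Finset.mem_image.1 hr
    exact h.genPos i j l (mt (congrArg P) hpq) (mt (congrArg P) hpr) (mt (congrArg P) hqr)
      (hdet i j l ▸ det2_eq_zero_of_collinear hc)
  · have hinj : Set.InjOn (fun p : Fin n × Fin n => s(P p.1, P p.2)) E := by
      intro p hp q hq hpq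
      rcases Sym2.eq_iff.1 hpq with ⟨h1, h2⟩ | ⟨h1, h2⟩
      · exact Prod.ext (hP h1) (hP h2)
      · have : q = p.swap := Prod.ext (hP h2).symm (hP h1).symm
        exact absurd (this ▸ hq) (h.asymm p hp)
    rw [← Finset.card_image_of_injOn hinj, ← Set.ncard_coe_finset]
    refine Set.ncard_le_ncard ?_ ?_
    · intro e he
      obtain ⟨p, hp, rfl⟩ := Finset.mem_image.1 (Finset.mem_coe.1 he)
      exact ⟨_, _, rfl, hhalf p hp⟩
    · refine (Finset.finite_toSet (Finset.univ.image P).sym2).subset ?_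
      rintro e ⟨p, q, rfl, hpq⟩
      exact Finset.mem_coe.2 (Finset.mk_mem_sym2_iff.2 ⟨hpq.1, hpq.2.1⟩)

theorem stmt19 (k : ℕ) (hk : 1 ≤ k) :
    ∃ S : Finset Pt, GenPos S ∧ S.card = 6 ^ k ∧
      k * 6 ^ k ≤ halvingEdgeCount S := by
  obtain ⟨x, y, E, h, hE⟩ := exists_isHalvingSystem_six_pow k
  obtain ⟨S, hS, hcard, hle⟩ := h.exists_finset
  exact ⟨S, hS, hcard, hE ▸ hle⟩
end
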